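/- Assume two designated variables X_a and X_b among X_1,…,X_d satisfy the noisy-copy condition with parameter λ > 0. Then for every G ∈ G_{d,k} there exists a graph G̃ ∈ G_{d,k} such that: (1) |score(G̃) − score(G)| < 3dλ; (2) X_b has no children in G̃; and (3) every variable other than X_a and X_b that is a child of X_a or of X_b in G is a child of X_a in G̃. -/

import Mathlib

open Finset

/-- Shannon entropy (in nats) of a discrete random variable `X` on a finite
probability space with probability mass function `μ`. -/
noncomputable def ent {Ω γ : Type*} [Fintype Ω] [Fintype γ] [DecidableEq γ]
    (μ : Ω → ℝ) (X : Ω → γ) : ℝ :=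
  ∑ x : γ, Real.negMulLog (∑ ω : Ω, if X ω = x then μ ω else 0)

/-- Conditional Shannon entropy H(X ∣ Y), via the chain rule `H(X ∣ Y) = H(X,Y) - H(Y)`. -/
noncomputable def condEnt {Ω γ δ : Type*} [Fintype Ω] [Fintype γ] [Fintype δ]
    [DecidableEq γ] [DecidableEq δ] (μ : Ω → ℝ) (X : Ω → γ) (Y : Ω → δ) : ℝ :=
  ent μ (fun ω => (X ω, Y ω)) - ent μ Y

/-- `μ` is a probability mass function on the finite sample space `Ω`. -/
def IsPMF {Ω : Type*} [Fintype Ω] (μ : Ω → ℝ) : Prop :=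
  (∀ ω, 0 ≤ μ ω) ∧ ∑ ω : Ω, μ ω = 1

/-- The joint value of the tuple of variables `X j` for `j` in the finite set `P`. -/
def tupleOf {d : ℕ} {Ω α : Type*} (X : Fin d → Ω → α) (P : Finset (Fin d)) :
    Ω → ({j // j ∈ P} → α) :=
  fun ω j => X j.1 ω

/-- The entropy H(f) of the family `f = ⟨X_i, P⟩`: the conditional Shannon entropy of the
child variable `X i` given the joint value of its parents, the variables `X j` for `j ∈ P`. -/
noncomputable def famEnt {d : ℕ} {Ω α : Type*} [Fintype Ω] [Fintype α] [DecidableEq α]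
    (μ : Ω → ℝ) (X : Fin d → Ω → α) (i : Fin d) (P : Finset (Fin d)) : ℝ :=
  condEnt μ (X i) (tupleOf X P)

/-- A relation is acyclic if no (nonempty) directed path leads from a vertex to itself. -/
def Acyclic {V : Type*} (r : V → V → Prop) : Prop :=
  ∀ v, ¬ Relation.TransGen r v v

/-- A graph over the `d` variables, given as the assignment `g` of a parent set to each
child variable, is in `𝒢_{d,k}`: no variable is its own parent, every variable has at
most `k` parents, and the parent → child edge relation is acyclic. -/
def IsDAGdk {d : ℕ} (k : ℕ) (g : Fin d → Finset (Fin d)) : Prop :=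
  (∀ i, i ∉ g i ∧ (g i).card ≤ k) ∧ Acyclic (fun u w => u ∈ g w)

/-- The score of the graph `g`: minus the sum of the entropies of its families. -/
noncomputable def score {d : ℕ} {Ω α : Type*} [Fintype Ω] [Fintype α] [DecidableEq α]
    (μ : Ω → ℝ) (X : Fin d → Ω → α) (g : Fin d → Finset (Fin d)) : ℝ :=
  -∑ i : Fin d, famEnt μ X i (g i)

/-- `S* := max_{G ∈ 𝒢_{d,k}} score(G)`, the optimal score. -/
noncomputable def Sstar {d : ℕ} {Ω α : Type*} [Fintype Ω] [Fintype α] [DecidableEq α]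
    (k : ℕ) (μ : Ω → ℝ) (X : Fin d → Ω → α) : ℝ :=
  sSup {s | ∃ g, IsDAGdk k g ∧ score μ X g = s}

/-- `g` restricted to the variables of `W` is a DAG over the variables of `W` with
in-degree at most `k` (all parents of variables of `W` are themselves in `W`). -/
def IsDAGon {d : ℕ} (k : ℕ) (W : Finset (Fin d)) (g : Fin d → Finset (Fin d)) : Prop :=
  (∀ i ∈ W, i ∉ g i ∧ (g i).card ≤ k ∧ g i ⊆ W) ∧
  Acyclic (fun u w => w ∈ W ∧ u ∈ g w)

/-- `g` restricted to `W` is a legal family set for `W`: one family (with at most `k`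
parents, drawn from all the variables) for each variable of `W`, with no directed cycle. -/
def LegalFamSet {d : ℕ} (k : ℕ) (W : Finset (Fin d)) (g : Fin d → Finset (Fin d)) : Prop :=
  (∀ i ∈ W, i ∉ g i ∧ (g i).card ≤ k) ∧ Acyclic (fun u w => w ∈ W ∧ u ∈ g w)

/-- The score of the set of families of the variables of `W` in `g`. -/
noncomputable def scoreOn {d : ℕ} {Ω α : Type*} [Fintype Ω] [Fintype α] [DecidableEq α]
    (μ : Ω → ℝ) (X : Fin d → Ω → α) (W : Finset (Fin d)) (g : Fin d → Finset (Fin d)) : ℝ :=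
  -∑ i ∈ W, famEnt μ X i (g i)

/-- The maximal score over DAGs with in-degree at most `k` over the variables of `W`. -/
noncomputable def SstarOn {d : ℕ} {Ω α : Type*} [Fintype Ω] [Fintype α] [DecidableEq α]
    (k : ℕ) (W : Finset (Fin d)) (μ : Ω → ℝ) (X : Fin d → Ω → α) : ℝ :=
  sSup {s | ∃ g, IsDAGon k W g ∧ scoreOn μ X W g = s}

/-- `X b` is a noisy copy of `X a` with parameter `lam`: `X b` is conditionally
independent of every subset `S` of the remaining variables given `X a` (expressed by
`H(X_b ∣ X_a, S) = H(X_b ∣ X_a)`), and `max(H(X_b ∣ X_a), H(X_a ∣ X_b)) ≤ lam`. -/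
def NoisyCopy {d : ℕ} {Ω α : Type*} [Fintype Ω] [Fintype α] [DecidableEq α]
    (μ : Ω → ℝ) (X : Fin d → Ω → α) (a b : Fin d) (lam : ℝ) : Prop :=
  (∀ S : Finset (Fin d), a ∉ S → b ∉ S →
      condEnt μ (X b) (fun ω => (X a ω, tupleOf X S ω)) = condEnt μ (X b) (X a)) ∧
  condEnt μ (X b) (X a) ≤ lam ∧ condEnt μ (X a) (X b) ≤ lam

/-- Law of `X` under `μ`. -/
noncomputable def law {Ω γ : Type*} [Fintype Ω] [DecidableEq γ]
    (μ : Ω → ℝ) (X : Ω → γ) (x : γ) : ℝ := ∑ ω : Ω, if X ω = x then μ ω else 0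

section entropy
variable {Ω γ δ ε : Type*} [Fintype Ω] [Fintype γ] [Fintype δ] [Fintype ε]
  [DecidableEq γ] [DecidableEq δ] [DecidableEq ε]

theorem law_nonneg {μ : Ω → ℝ} (hμ : IsPMF μ) (X : Ω → γ) (x : γ) : 0 ≤ law μ X x := by
  unfold law
  refine Finset.sum_nonneg fun ω _ => ?_
  split_ifs
  · exact hμ.1 ω
  · exact le_rfl

theorem le_law {μ : Ω → ℝ} (hμ : IsPMF μ) (X : Ω → γ) (ω : Ω) : μ ω ≤ law μ X (X ω) := by
  unfold law
  have := Finset.single_le_sum (f := fun ω' => if X ω' = X ω then μ ω' else 0)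
    (s := Finset.univ) (fun ω' _ => by
      split_ifs
      · exact hμ.1 ω'
      · exact le_rfl) (Finset.mem_univ ω)
  simpa using this

theorem law_mono {μ : Ω → ℝ} (hμ : IsPMF μ) (Y : Ω → γ) (f : γ → δ) (y : γ) :
    law μ Y y ≤ law μ (fun ω => f (Y ω)) (f y) := by
  unfold law
  refine Finset.sum_le_sum fun ω _ => ?_
  by_cases h : Y ω = y
  · simp [h]
  · simp only [h, if_false]
    split_ifs
    · exact hμ.1 ω
    · exact le_rfl

theorem sum_law_mul (μ : Ω → ℝ) (X : Ω → γ) (g : γ → ℝ) :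
    ∑ x, law μ X x * g x = ∑ ω, μ ω * g (X ω) := by
  unfold law
  simp_rw [Finset.sum_mul]
  rw [Finset.sum_comm]
  refine Finset.sum_congr rfl fun ω _ => ?_
  simp

theorem sum_law {μ : Ω → ℝ} (hμ : IsPMF μ) (X : Ω → γ) : ∑ x, law μ X x = 1 := by
  have := sum_law_mul μ X (fun _ => 1)
  simp only [mul_one] at this
  rw [this, hμ.2]

theorem sum_law_fst (μ : Ω → ℝ) (A : Ω → γ) (Y : Ω → δ) (y : δ) :
    ∑ x, law μ (fun ω => (A ω, Y ω)) (x, y) = law μ Y y := by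
  unfold law
  rw [Finset.sum_comm]
  refine Finset.sum_congr rfl fun ω _ => ?_
  by_cases h : Y ω = y <;> simp [h]

theorem ent_eq (μ : Ω → ℝ) (X : Ω → γ) :
    ent μ X = -∑ ω, μ ω * Real.log (law μ X (X ω)) := by
  rw [← sum_law_mul μ X (fun x => Real.log (law μ X x)), ← Finset.sum_neg_distrib]
  unfold ent
  refine Finset.sum_congr rfl fun x _ => ?_
  simp [Real.negMulLog, law]

theorem ent_comp_le {μ : Ω → ℝ} (hμ : IsPMF μ) (Y : Ω → γ) (f : γ → δ) :
    ent μ (fun ω => f (Y ω)) ≤ ent μ Y := by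
  rw [ent_eq, ent_eq, neg_le_neg_iff]
  refine Finset.sum_le_sum fun ω _ => ?_
  rcases (hμ.1 ω).eq_or_lt with h | h
  · simp [← h]
  · exact mul_le_mul_of_nonneg_left
      (Real.log_le_log (h.trans_le (le_law hμ Y ω)) (law_mono hμ Y f (Y ω))) h.le

theorem ent_congr {μ : Ω → ℝ} (hμ : IsPMF μ) (Y : Ω → γ) (Z : Ω → δ) (f : γ → δ) (g : δ → γ)
    (hf : ∀ ω, f (Y ω) = Z ω) (hg : ∀ ω, g (Z ω) = Y ω) : ent μ Y = ent μ Z := by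
  have h1 := ent_comp_le hμ Y f
  have h2 := ent_comp_le hμ Z g
  simp only [hf, hg] at h1 h2
  exact le_antisymm h2 h1

theorem condEnt_le_comp {μ : Ω → ℝ} (hμ : IsPMF μ) (A : Ω → γ) (Y : Ω → δ) (f : δ → ε) :
    condEnt μ A Y ≤ condEnt μ A (fun ω => f (Y ω)) := by
  set pAY := law μ (fun ω => (A ω, Y ω)) with hpAY
  set pY := law μ Y with hpY
  set pAZ := law μ (fun ω => (A ω, f (Y ω))) with hpAZ
  set pZ := law μ (fun ω => f (Y ω)) with hpZ
  -- pointwise bound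
  have key : ∀ ω, μ ω * (1 - pY (Y ω) * pAZ (A ω, f (Y ω)) / (pAY (A ω, Y ω) * pZ (f (Y ω)))) ≤
      μ ω * (Real.log (pAY (A ω, Y ω)) + Real.log (pZ (f (Y ω))) - Real.log (pY (Y ω))
        - Real.log (pAZ (A ω, f (Y ω)))) := by
    intro ω
    rcases (hμ.1 ω).eq_or_lt with h | h
    · simp [← h]
    refine mul_le_mul_of_nonneg_left ?_ h.le
    have h1 : 0 < pAY (A ω, Y ω) := h.trans_le (le_law hμ (fun ω => (A ω, Y ω)) ω)
    have h2 : 0 < pY (Y ω) := h.trans_le (le_law hμ Y ω)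
    have h3 : 0 < pAZ (A ω, f (Y ω)) := h.trans_le (le_law hμ (fun ω => (A ω, f (Y ω))) ω)
    have h4 : 0 < pZ (f (Y ω)) := h.trans_le (le_law hμ (fun ω => f (Y ω)) ω)
    have := Real.log_le_sub_one_of_pos
      (x := pY (Y ω) * pAZ (A ω, f (Y ω)) / (pAY (A ω, Y ω) * pZ (f (Y ω)))) (by positivity)
    rw [Real.log_div (by positivity) (by positivity), Real.log_mul h2.ne' h3.ne',
      Real.log_mul h1.ne' h4.ne'] at this
    linarith
  have hsum : ∑ ω, μ ω * (pY (Y ω) * pAZ (A ω, f (Y ω)) / (pAY (A ω, Y ω) * pZ (f (Y ω)))) ≤ 1 := by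
    rw [← sum_law_mul μ (fun ω => (A ω, Y ω))
      (fun z => pY z.2 * pAZ (z.1, f z.2) / (pAY z * pZ (f z.2)))]
    calc ∑ z : γ × δ, pAY z * (pY z.2 * pAZ (z.1, f z.2) / (pAY z * pZ (f z.2)))
        ≤ ∑ z : γ × δ, pY z.2 * pAZ (z.1, f z.2) / pZ (f z.2) := by
          refine Finset.sum_le_sum fun z _ => ?_
          have h2 : 0 ≤ pY z.2 := law_nonneg hμ _ _
          have h3 : 0 ≤ pAZ (z.1, f z.2) := law_nonneg hμ _ _
          have h4 : 0 ≤ pZ (f z.2) := law_nonneg hμ _ _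
          rcases eq_or_ne (pAY z) 0 with h | h
          · rw [h]; simp only [zero_mul]; positivity
          · rw [← mul_div_assoc, mul_div_mul_left _ _ h]
      _ = ∑ y : δ, pY y * (pZ (f y) / pZ (f y)) := by
          rw [Fintype.sum_prod_type_right]
          refine Finset.sum_congr rfl fun y _ => ?_
          have : ∑ x, pAZ (x, f y) = pZ (f y) := sum_law_fst μ A (fun ω => f (Y ω)) (f y)
          simp_rw [mul_div_assoc]
          rw [← Finset.mul_sum, ← Finset.sum_div, this]
      _ ≤ ∑ y : δ, pY y := by
          refine Finset.sum_le_sum fun y _ => ?_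
          exact mul_le_of_le_one_right (law_nonneg hμ _ _) (div_self_le_one _)
      _ = 1 := sum_law hμ Y
  have hs := Finset.sum_le_sum fun ω (_ : ω ∈ (Finset.univ : Finset Ω)) => key ω
  simp only [mul_sub, mul_add, mul_one, Finset.sum_sub_distrib, Finset.sum_add_distrib, hμ.2] at hs
  unfold condEnt
  rw [ent_eq, ent_eq, ent_eq, ent_eq]
  linarith

end entropy

section tuples
variable {d : ℕ} {Ω α : Type*} [Fintype Ω] [Fintype α] [DecidableEq α]

/-- Entropy of a set of variables. -/
noncomputable def hset (μ : Ω → ℝ) (X : Fin d → Ω → α) (S : Finset (Fin d)) : ℝ :=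
  ent μ (tupleOf X S)

theorem hset_mono {μ : Ω → ℝ} (hμ : IsPMF μ) (X : Fin d → Ω → α) {S T : Finset (Fin d)}
    (h : S ⊆ T) : hset μ X S ≤ hset μ X T :=
  ent_comp_le hμ (tupleOf X T) (fun t (j : {j // j ∈ S}) => t ⟨j.1, h j.2⟩)

theorem ent_insert {μ : Ω → ℝ} (hμ : IsPMF μ) (X : Fin d → Ω → α) (i : Fin d)
    (S : Finset (Fin d)) :
    ent μ (fun ω => (X i ω, tupleOf X S ω)) = hset μ X (insert i S) := by
  refine ent_congr hμ _ _
    (fun z (j : {j // j ∈ insert i S}) => if h : j.1 ∈ S then z.2 ⟨j.1, h⟩ else z.1)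
    (fun t => (t ⟨i, Finset.mem_insert_self i S⟩,
      fun j : {j // j ∈ S} => t ⟨j.1, Finset.mem_insert_of_mem j.2⟩)) ?_ ?_
  · intro ω
    funext j
    by_cases h : j.1 ∈ S
    · simp [h, tupleOf]
    · have : j.1 = i := by
        have := j.2
        simp only [Finset.mem_insert] at this
        tauto
      simp [h, tupleOf, this]
  · intro ω; rfl

theorem famEnt_eq {μ : Ω → ℝ} (hμ : IsPMF μ) (X : Fin d → Ω → α) (i : Fin d)
    (S : Finset (Fin d)) : famEnt μ X i S = hset μ X (insert i S) - hset μ X S := by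
  unfold famEnt condEnt
  rw [ent_insert hμ]; rfl

theorem famEnt_le_condEnt {μ : Ω → ℝ} (hμ : IsPMF μ) (X : Fin d → Ω → α) (i j : Fin d)
    (S : Finset (Fin d)) (hj : j ∈ S) : famEnt μ X i S ≤ condEnt μ (X i) (X j) :=
  condEnt_le_comp hμ (X i) (tupleOf X S) (fun t => t ⟨j, hj⟩)

theorem famEnt_anti {μ : Ω → ℝ} (hμ : IsPMF μ) (X : Fin d → Ω → α) (i : Fin d)
    {S T : Finset (Fin d)} (h : S ⊆ T) : famEnt μ X i T ≤ famEnt μ X i S :=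
  condEnt_le_comp hμ (X i) (tupleOf X T) (fun t (j : {j // j ∈ S}) => t ⟨j.1, h j.2⟩)

/-- `H(v ∣ R, b) ≤ H(v ∣ R, a) + H(a ∣ b)`. -/
theorem famEnt_replace_le {μ : Ω → ℝ} (hμ : IsPMF μ) (X : Fin d → Ω → α) (v a b : Fin d)
    (R : Finset (Fin d)) :
    famEnt μ X v (insert b R) ≤ famEnt μ X v (insert a R) + condEnt μ (X a) (X b) := by
  have h1 := famEnt_le_condEnt hμ X a b (insert b R) (Finset.mem_insert_self _ _)
  have h2 : famEnt μ X v (insert a (insert b R)) ≤ famEnt μ X v (insert a R) :=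
    famEnt_anti hμ X v (Finset.insert_subset_insert _ (Finset.subset_insert _ _))
  have h3 : hset μ X (insert v (insert b R)) ≤ hset μ X (insert v (insert a (insert b R))) :=
    hset_mono hμ X (Finset.insert_subset_insert _ (Finset.subset_insert _ _))
  rw [famEnt_eq hμ] at h1
  rw [famEnt_eq hμ X v (insert a (insert b R))] at h2
  rw [famEnt_eq hμ X v (insert b R)]
  linarith

/-- `H(a ∣ P) ≤ H(b ∣ P) + H(a ∣ b)`. -/
theorem famEnt_child_le {μ : Ω → ℝ} (hμ : IsPMF μ) (X : Fin d → Ω → α) (a b : Fin d)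
    (P : Finset (Fin d)) :
    famEnt μ X a P ≤ famEnt μ X b P + condEnt μ (X a) (X b) := by
  have h1 := famEnt_le_condEnt hμ X a b (insert b P) (Finset.mem_insert_self _ _)
  have h3 : hset μ X (insert a P) ≤ hset μ X (insert a (insert b P)) :=
    hset_mono hμ X (Finset.insert_subset_insert _ (Finset.subset_insert _ _))
  rw [famEnt_eq hμ] at h1
  rw [famEnt_eq hμ, famEnt_eq hμ]
  linarith

/-- Replace `b` by `a` in a parent set. -/
def repl (a b : Fin d) (P : Finset (Fin d)) : Finset (Fin d) :=
  if b ∈ P then insert a (P.erase b) else P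

theorem repl_card (a b : Fin d) (P : Finset (Fin d)) : (repl a b P).card ≤ P.card := by
  unfold repl
  split_ifs with h
  · have := Finset.card_insert_le a (P.erase b)
    rwa [Finset.card_erase_add_one h] at this
  · exact le_rfl

theorem mem_repl {a b u : Fin d} {P : Finset (Fin d)} (hu : u ∈ repl a b P) :
    u ∈ P ∨ (u = a ∧ b ∈ P) := by
  unfold repl at hu
  split_ifs at hu with h
  · simp only [Finset.mem_insert, Finset.mem_erase] at hu
    tauto
  · exact Or.inl hu

theorem not_mem_repl {a b : Fin d} (hab : a ≠ b) (P : Finset (Fin d)) : b ∉ repl a b P := by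
  unfold repl
  split_ifs with h
  · simp [hab.symm]
  · exact h

theorem mem_repl_of {a b : Fin d} (hab : a ≠ b) {P : Finset (Fin d)} (h : a ∈ P ∨ b ∈ P) :
    a ∈ repl a b P := by
  unfold repl
  split_ifs with h'
  · simp
  · tauto

theorem famEnt_repl {μ : Ω → ℝ} (hμ : IsPMF μ) (X : Fin d → Ω → α) (a b v : Fin d)
    (P : Finset (Fin d)) {lam : ℝ} (hlam : 0 < lam)
    (h1 : condEnt μ (X b) (X a) ≤ lam) (h2 : condEnt μ (X a) (X b) ≤ lam) :
    |famEnt μ X v (repl a b P) - famEnt μ X v P| ≤ lam := by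
  unfold repl
  split_ifs with h
  · have e1 := famEnt_replace_le hμ X v a b (P.erase b)
    have e2 := famEnt_replace_le hμ X v b a (P.erase b)
    rw [Finset.insert_erase h] at e1 e2
    rw [abs_le]
    constructor <;> linarith
  · simpa using hlam.le

theorem exists_rank {r : Fin d → Fin d → Prop} (h : Acyclic r) :
    ∃ f : Fin d → ℕ, ∀ u w, r u w → f u < f w := by
  classical
  refine ⟨fun w => (Finset.univ.filter fun u => Relation.TransGen r u w).card, ?_⟩
  intro u w huw
  apply Finset.card_lt_card
  rw [Finset.ssubset_iff_of_subset]
  · exact ⟨u, by simpa using Relation.TransGen.single huw, by simpa using h u⟩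
  · intro x hx
    simp only [Finset.mem_filter, Finset.mem_univ, true_and] at hx ⊢
    exact hx.tail huw

theorem acyclic_of_rank {r : Fin d → Fin d → Prop} (f : Fin d → ℕ)
    (h : ∀ u w, r u w → f u < f w) : Acyclic r := by
  have : ∀ u w, Relation.TransGen r u w → f u < f w := by
    intro u w huw
    induction huw with
    | single h' => exact h _ _ h'
    | tail _ h' ih => exact ih.trans (h _ _ h')
  exact fun v hv => lt_irrefl _ (this v v hv)

/-- The score bound for a relabelled graph. -/
theorem score_bound {μ : Ω → ℝ} (hμ : IsPMF μ) (X : Fin d → Ω → α) (a b : Fin d)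
    (hd : 1 ≤ d) {lam : ℝ} (hlam : 0 < lam)
    (h1 : condEnt μ (X b) (X a) ≤ lam) (h2 : condEnt μ (X a) (X b) ≤ lam)
    (G : Fin d → Finset (Fin d)) (σ : Equiv.Perm (Fin d))
    (hσ : σ = 1 ∨ σ = Equiv.swap a b) :
    |score μ X (fun v => repl a b (G (σ v))) - score μ X G| < 3 * d * lam := by
  have hG : score μ X G = -∑ v, famEnt μ X (σ v) (G (σ v)) := by
    unfold score
    rw [Equiv.sum_comp σ (fun i => famEnt μ X i (G i))]
  have hch : ∀ v P, |famEnt μ X v P - famEnt μ X (σ v) P| ≤ lam := by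
    intro v P
    have e1 := famEnt_child_le hμ X a b P
    have e2 := famEnt_child_le hμ X b a P
    rcases hσ with rfl | rfl
    · simpa using hlam.le
    · by_cases ha : v = a
      · subst ha
        rw [Equiv.swap_apply_left, abs_le]
        constructor <;> linarith
      · by_cases hb : v = b
        · subst hb
          rw [Equiv.swap_apply_right, abs_le]
          constructor <;> linarith
        · rw [Equiv.swap_apply_of_ne_of_ne ha hb]
          simpa using hlam.le
  have hbd : ∀ v, |famEnt μ X (σ v) (G (σ v)) - famEnt μ X v (repl a b (G (σ v)))| ≤ 2 * lam := by
    intro v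
    have e1 := hch v (G (σ v))
    have e2 := famEnt_repl hμ X a b v (G (σ v)) hlam h1 h2
    rw [abs_le] at *
    constructor <;> linarith
  have : score μ X (fun v => repl a b (G (σ v))) - score μ X G =
      ∑ v, (famEnt μ X (σ v) (G (σ v)) - famEnt μ X v (repl a b (G (σ v)))) := by
    rw [hG, Finset.sum_sub_distrib]
    unfold score
    ring
  rw [this]
  have hd' : (1 : ℝ) ≤ d := by exact_mod_cast hd
  calc _ ≤ ∑ v, |famEnt μ X (σ v) (G (σ v)) - famEnt μ X v (repl a b (G (σ v)))| :=
        Finset.abs_sum_le_sum_abs _ _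
    _ ≤ ∑ _v : Fin d, 2 * lam := Finset.sum_le_sum fun v _ => hbd v
    _ = d * (2 * lam) := by simp
    _ < 3 * d * lam := by nlinarith

end tuples

theorem exists_graph_without_noisy_children
    {d k : ℕ} {Ω α : Type*} [Fintype Ω] [Fintype α] [DecidableEq α]
    (hd : 1 ≤ d) (hk : 1 ≤ k)
    (μ : Ω → ℝ) (hμ : IsPMF μ) (X : Fin d → Ω → α)
    (lam : ℝ) (hlam : 0 < lam) (a b : Fin d) (hab : a ≠ b)
    (hnc : NoisyCopy μ X a b lam)
    (G : Fin d → Finset (Fin d)) (hG : IsDAGdk k G) :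
    ∃ Gt : Fin d → Finset (Fin d), IsDAGdk k Gt ∧
      |score μ X Gt - score μ X G| < 3 * d * lam ∧
      (∀ v, b ∉ Gt v) ∧
      (∀ v, v ≠ a → v ≠ b → (a ∈ G v ∨ b ∈ G v) → a ∈ Gt v) := by
  obtain ⟨-, hba, hab'⟩ := hnc
  obtain ⟨hG1, hG2⟩ := hG
  obtain ⟨f, hf⟩ := exists_rank hG2
  -- it is enough to give a relabelling and a rank function
  suffices H : ∃ σ : Equiv.Perm (Fin d), (σ = 1 ∨ σ = Equiv.swap a b) ∧
      ∃ f' : Fin d → ℕ, ∀ u v, u ∈ repl a b (G (σ v)) → f' u < f' v by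
    obtain ⟨σ, hσ, f', hf'⟩ := H
    refine ⟨fun v => repl a b (G (σ v)), ⟨fun i => ⟨fun hi => lt_irrefl _ (hf' i i hi),
      (repl_card a b _).trans (hG1 _).2⟩, acyclic_of_rank f' hf'⟩,
      score_bound hμ X a b hd hlam hba hab' G σ hσ, fun v => not_mem_repl hab _, ?_⟩
    intro v hva hvb hv
    have : σ v = v := by
      rcases hσ with rfl | rfl
      · rfl
      · exact Equiv.swap_apply_of_ne_of_ne hva hvb
    simp only [this]
    exact mem_repl_of hab hv
  rcases le_or_gt (f a) (f b) with hle | hlt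
  · refine ⟨1, Or.inl rfl, f, ?_⟩
    intro u v hu
    rcases mem_repl hu with h | ⟨rfl, h⟩
    · exact hf _ _ h
    · exact hle.trans_lt (hf _ _ h)
  · refine ⟨Equiv.swap a b, Or.inr rfl,
      fun v => if v = b then ∑ i, f i + 1 else if v = a then f b else f v, ?_⟩
    have hbig : ∀ i, f i < ∑ i, f i + 1 := fun i =>
      Nat.lt_succ_of_le (Finset.single_le_sum (f := f) (fun _ _ => Nat.zero_le _)
        (Finset.mem_univ i))
    intro u v hu
    have hub : u ≠ b := by
      rintro rfl
      exact not_mem_repl hab _ hu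
    have hm := mem_repl hu
    simp only [hub, if_false]
    by_cases hvb : v = b
    · simp only [hvb, if_true]
      split_ifs
      · exact hbig _
      · exact hbig _
    simp only [hvb, if_false]
    by_cases hva : v = a
    · subst hva
      rw [Equiv.swap_apply_left] at hm
      simp only [if_true]
      rcases hm with h | ⟨-, h⟩
      · have h' := hf _ _ h
        split_ifs with hu'
        · subst hu'; omega
        · exact h'
      · exact absurd h (hG1 b).1
    · rw [Equiv.swap_apply_of_ne_of_ne hva hvb] at hm
      simp only [hva, if_false]
      rcases hm with h | ⟨hu', h⟩
      · have h' := hf _ _ h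
        split_ifs with hu'
        · subst hu'; omega
        · exact h'
      · simp only [hu', if_true]
        exact hf _ _ h
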